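/- Stability of the MAC-E scheme: there exists a constant C > 0 depending only on λ and μ (independent of the partitions) such that every solution (W^x, W^y, Z^{11}, Z^{22}, Z^{12}) of the MAC-E scheme with data f¹, f² satisfies (1/μ)‖Z^{12}‖_T + (1/(2λ+2μ))(‖Z^{11}‖_M + ‖Z^{22}‖_M) + (‖W^x‖_{TM}² + ‖W^y‖_{MT}²)^{1/2} ≤ C(‖f¹‖_{TM} + ‖f²‖_{MT}). -/

import Mathlib

open Finset

noncomputable section

/-- The midpoint `x_{i+1/2} = (x_i + x_{i+1})/2`. -/
def midpt (x : ℕ → ℝ) (i : ℕ) : ℝ := (x i + x (i + 1)) / 2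

/-- The cell width `h_{i+1/2} = x_{i+1} - x_i`. -/
def hMid (x : ℕ → ℝ) (i : ℕ) : ℝ := x (i + 1) - x i

/-- `h_i = x_{i+1/2} - x_{i-1/2}` for `1 ≤ i ≤ n-1`, together with the boundary
conventions `h_0 = h_{1/2}/2` and `h_n = h_{n-1/2}/2`. -/
def hNode (x : ℕ → ℝ) (n i : ℕ) : ℝ :=
  if i = 0 then hMid x 0 / 2
  else if i = n then hMid x (n - 1) / 2
  else midpt x i - midpt x (i - 1)

/-- `0 = x_0 < x_1 < ⋯ < x_n = 1`. -/
def IsGrid (x : ℕ → ℝ) (n : ℕ) : Prop :=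
  x 0 = 0 ∧ x n = 1 ∧ ∀ i < n, x i < x (i + 1)

/-- Discrete inner product `(φ,θ)_M` over the cell centers `(x_{i+1/2}, y_{j+1/2})`. -/
def ipM (x y : ℕ → ℝ) (nx ny : ℕ) (φ θ : ℕ → ℕ → ℝ) : ℝ :=
  ∑ i ∈ range nx, ∑ j ∈ range ny, hMid x i * hMid y j * φ i j * θ i j

/-- Discrete inner product `(φ,θ)_T` over the grid nodes `(x_i, y_j)`. -/
def ipT (x y : ℕ → ℝ) (nx ny : ℕ) (φ θ : ℕ → ℕ → ℝ) : ℝ :=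
  ∑ i ∈ range (nx + 1), ∑ j ∈ range (ny + 1), hNode x nx i * hNode y ny j * φ i j * θ i j

/-- Discrete inner product `(φ,θ)_{TM}` over the points `(x_i, y_{j+1/2})`,
`1 ≤ i ≤ n_x - 1`, `0 ≤ j ≤ n_y - 1`. -/
def ipTM (x y : ℕ → ℝ) (nx ny : ℕ) (φ θ : ℕ → ℕ → ℝ) : ℝ :=
  ∑ i ∈ Ico 1 nx, ∑ j ∈ range ny, hNode x nx i * hMid y j * φ i j * θ i j

/-- Discrete inner product `(φ,θ)_{MT}` over the points `(x_{i+1/2}, y_j)`,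
`0 ≤ i ≤ n_x - 1`, `1 ≤ j ≤ n_y - 1`. -/
def ipMT (x y : ℕ → ℝ) (nx ny : ℕ) (φ θ : ℕ → ℕ → ℝ) : ℝ :=
  ∑ i ∈ range nx, ∑ j ∈ Ico 1 ny, hMid x i * hNode y ny j * φ i j * θ i j

/-- `D_y` of an edge function `v` given at `(x-index, y_{j+1/2})` with extra boundary
rows `v0` (at `y_0`) and `vn` (at `y_{n_y}`); the result is a node function. -/
def DyE (y : ℕ → ℝ) (ny : ℕ) (v : ℕ → ℕ → ℝ) (v0 vn : ℕ → ℝ) (i j : ℕ) : ℝ :=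
  if j = 0 then (v i 0 - v0 i) / hNode y ny 0
  else if j = ny then (vn i - v i (ny - 1)) / hNode y ny ny
  else (v i j - v i (j - 1)) / hNode y ny j

/-- `D_x` of an edge function `v` given at `(x_{i+1/2}, y-index)` with extra boundary
columns `v0` (at `x_0`) and `vn` (at `x_{n_x}`); the result is a node function. -/
def DxE (x : ℕ → ℝ) (nx : ℕ) (v : ℕ → ℕ → ℝ) (v0 vn : ℕ → ℝ) (i j : ℕ) : ℝ :=
  if i = 0 then (v 0 j - v0 j) / hNode x nx 0
  else if i = nx then (vn j - v (nx - 1) j) / hNode x nx nx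
  else (v i j - v (i - 1) j) / hNode x nx i

/-- The MAC-E scheme on the staggered grid: `(Wx, Wy, Z11, Z22, Z12)` (with the extra
boundary rows/columns `Wx0, Wxn` of `Wx` at `y = y_0, y_{n_y}` and `Wy0, Wyn` of `Wy`
at `x = x_0, x_{n_x}`) solves the scheme with data `f1, f2`. -/
def MACESol (nx ny : ℕ) (x y : ℕ → ℝ) (lam mu : ℝ)
    (Wx : ℕ → ℕ → ℝ) (Wx0 Wxn : ℕ → ℝ)
    (Wy : ℕ → ℕ → ℝ) (Wy0 Wyn : ℕ → ℝ)
    (Z11 Z22 Z12 f1 f2 : ℕ → ℕ → ℝ) : Prop :=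
  -- boundary conditions for the displacements
  (∀ j < ny, Wx 0 j = 0 ∧ Wx nx j = 0) ∧
  (∀ i ≤ nx, Wx0 i = 0 ∧ Wxn i = 0) ∧
  (∀ i < nx, Wy i 0 = 0 ∧ Wy i ny = 0) ∧
  (∀ j ≤ ny, Wy0 j = 0 ∧ Wyn j = 0) ∧
  -- constitutive equations at the cell centers
  (∀ i < nx, ∀ j < ny,
    (1 / (2 * mu)) * (Z11 i j - lam / (2 * lam + 2 * mu) * (Z11 i j + Z22 i j))
      = (Wx (i + 1) j - Wx i j) / hMid x i) ∧
  (∀ i < nx, ∀ j < ny,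
    (1 / (2 * mu)) * (Z22 i j - lam / (2 * lam + 2 * mu) * (Z11 i j + Z22 i j))
      = (Wy i (j + 1) - Wy i j) / hMid y j) ∧
  -- shear stress equation at the grid nodes
  (∀ i ≤ nx, ∀ j ≤ ny,
    Z12 i j = mu * (DyE y ny Wx Wx0 Wxn i j + DxE x nx Wy Wy0 Wyn i j)) ∧
  -- momentum equations
  (∀ i, 1 ≤ i → i < nx → ∀ j < ny,
    (Z11 i j - Z11 (i - 1) j) / hNode x nx i
      + (Z12 i (j + 1) - Z12 i j) / hMid y j = f1 i j) ∧
  (∀ i < nx, ∀ j, 1 ≤ j → j < ny →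
    (Z12 (i + 1) j - Z12 i j) / hMid x i
      + (Z22 i j - Z22 i (j - 1)) / hNode y ny j = f2 i j)

theorem IsGrid.hMid_pos {x : ℕ → ℝ} {n i : ℕ} (hx : IsGrid x n) (hi : i < n) : 0 < hMid x i :=
  sub_pos.2 (hx.2.2 i hi)

theorem hNode_of_interior (x : ℕ → ℝ) {n i : ℕ} (h0 : 1 ≤ i) (hi : i < n) :
    hNode x n i = (hMid x i + hMid x (i - 1)) / 2 := by
  obtain ⟨k, rfl⟩ : ∃ k, i = k + 1 := ⟨i - 1, by omega⟩
  simp only [hNode, hMid, midpt, Nat.add_sub_cancel, Nat.add_eq_zero_iff, one_ne_zero, and_false,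
    if_false, hi.ne]
  ring

theorem IsGrid.hNode_pos {x : ℕ → ℝ} {n i : ℕ} (hx : IsGrid x n) (hn : 1 ≤ n) (hi : i ≤ n) :
    0 < hNode x n i := by
  rcases Nat.eq_zero_or_pos i with rfl | h0
  · simpa [hNode] using hx.hMid_pos hn
  rcases hi.eq_or_lt with rfl | hlt
  · simpa [hNode, h0.ne'] using hx.hMid_pos (Nat.sub_lt h0 one_pos)
  · rw [hNode_of_interior x h0 hlt]
    have h1 := hx.hMid_pos hlt
    have h2 := hx.hMid_pos (i := i - 1) (by omega)
    linarith

theorem IsGrid.nonneg_and_le_one {x : ℕ → ℝ} {n : ℕ} (hx : IsGrid x n) :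
    ∀ i ≤ n, 0 ≤ x i ∧ x i ≤ 1 := by
  have hmono : ∀ i j, i ≤ j → j ≤ n → x i ≤ x j := by
    intro i j hij
    induction j, hij using Nat.le_induction with
    | base => exact fun _ => le_rfl
    | succ j _ ih => exact fun hj => (ih (by omega)).trans (hx.2.2 j (by omega)).le
  intro i hi
  exact ⟨hx.1 ▸ hmono 0 i (Nat.zero_le i) hi, hx.2.1 ▸ hmono i n hi le_rfl⟩

theorem IsGrid.sum_hNode_le_one {x : ℕ → ℝ} {n : ℕ} (hx : IsGrid x n) (hn : 1 ≤ n) :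
    ∑ i ∈ Ico 1 n, hNode x n i ≤ 1 := by
  have key : ∀ m, ∑ i ∈ Ico 1 (m + 1), (hMid x i + hMid x (i - 1)) / 2
      = (x (m + 1) + x m - x 1 - x 0) / 2 := by
    intro m
    induction m with
    | zero => simp
    | succ m ih =>
      rw [sum_Ico_succ_top (by omega), ih]
      simp only [hMid, Nat.add_sub_cancel]
      ring
  obtain ⟨m, rfl⟩ : ∃ m, n = m + 1 := ⟨n - 1, by omega⟩
  rw [sum_congr rfl fun i hi =>
    hNode_of_interior x (mem_Ico.1 hi).1 (mem_Ico.1 hi).2, key]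
  linarith [(hx.nonneg_and_le_one (m + 1) le_rfl).2, (hx.nonneg_and_le_one m (by omega)).2,
    (hx.nonneg_and_le_one 1 (by omega)).1, (hx.nonneg_and_le_one 0 (by omega)).1]

/-- Summation by parts for a function vanishing at both end points. -/
theorem sum_Ico_sub_mul {n : ℕ} (hn : 1 ≤ n) (a u : ℕ → ℝ) (h0 : u 0 = 0) (hu : u n = 0) :
    ∑ i ∈ Ico 1 n, (a i - a (i - 1)) * u i = -∑ i ∈ range n, a i * (u (i + 1) - u i) := by
  have key : ∀ m, ∑ i ∈ Ico 1 (m + 1), (a i - a (i - 1)) * u i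
      + ∑ i ∈ range (m + 1), a i * (u (i + 1) - u i) = a m * u (m + 1) - a 0 * u 0 := by
    intro m
    induction m with
    | zero => simp; ring
    | succ m ih =>
      rw [sum_Ico_succ_top (by omega), sum_range_succ _ (m + 1), Nat.add_sub_cancel]
      linear_combination ih
  obtain ⟨m, rfl⟩ : ∃ m, n = m + 1 := ⟨n - 1, by omega⟩
  have := key m
  rw [h0, hu] at this
  linarith

/-- Summation by parts against `D_y` of a function with zero boundary rows. -/
theorem IsGrid.sum_range_sub_mul {y : ℕ → ℝ} {n : ℕ} (hy : IsGrid y n) (hn : 1 ≤ n)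
    (b : ℕ → ℝ) (v : ℕ → ℕ → ℝ) (v0 vn : ℕ → ℝ) (i : ℕ) (h0 : v0 i = 0) (hvn : vn i = 0) :
    ∑ j ∈ range n, (b (j + 1) - b j) * v i j
      = -∑ j ∈ range (n + 1), hNode y n j * b j * DyE y n v v0 vn i j := by
  have key : ∀ m, ∑ k ∈ range m, b (k + 1) * (v i (k + 1) - v i k)
      + ∑ j ∈ range (m + 1), (b (j + 1) - b j) * v i j = b (m + 1) * v i m - b 0 * v i 0 := by
    intro m
    induction m with
    | zero => simp; ring
    | succ m ih =>
      rw [sum_range_succ, sum_range_succ _ (m + 1)]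
      linear_combination ih
  obtain ⟨m, rfl⟩ : ∃ m, n = m + 1 := ⟨n - 1, by omega⟩
  have e0 : hNode y (m + 1) 0 * b 0 * DyE y (m + 1) v v0 vn i 0 = b 0 * v i 0 := by
    have := (hy.hNode_pos hn (Nat.zero_le _)).ne'
    simp only [DyE, if_true, h0]
    field_simp
    ring
  have e1 : hNode y (m + 1) (m + 1) * b (m + 1) * DyE y (m + 1) v v0 vn i (m + 1)
      = -(b (m + 1) * v i m) := by
    have := (hy.hNode_pos hn le_rfl).ne'
    simp only [DyE, if_true, hvn, Nat.add_eq_zero_iff, one_ne_zero, and_false, if_false,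
      Nat.add_sub_cancel]
    field_simp
    ring
  have e2 : ∑ k ∈ range m, hNode y (m + 1) (k + 1) * b (k + 1) * DyE y (m + 1) v v0 vn i (k + 1)
      = ∑ k ∈ range m, b (k + 1) * (v i (k + 1) - v i k) := by
    refine sum_congr rfl fun k hk => ?_
    have hk := mem_range.1 hk
    have := (hy.hNode_pos (i := k + 1) hn (by omega)).ne'
    have hne : k + 1 ≠ m + 1 := by omega
    simp only [DyE, Nat.add_eq_zero_iff, one_ne_zero, and_false, if_false, hne,
      Nat.add_sub_cancel]
    field_simp
  rw [sum_range_succ (fun j => hNode y (m + 1) j * b j * DyE y (m + 1) v v0 vn i j) (m + 1),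
    sum_range_succ' (fun j => hNode y (m + 1) j * b j * DyE y (m + 1) v v0 vn i j) m, e0, e1, e2]
  linarith [key m]

/-- One-dimensional discrete Poincaré inequality in the maximum norm. -/
theorem IsGrid.sq_le_sum {x : ℕ → ℝ} {n k : ℕ} (hx : IsGrid x n) (hk : k ≤ n) (u : ℕ → ℝ)
    (h0 : u 0 = 0) :
    u k ^ 2 ≤ ∑ i ∈ range n, hMid x i * ((u (i + 1) - u i) / hMid x i) ^ 2 := by
  have hpos : ∀ i ∈ range n, 0 < hMid x i := fun i hi => hx.hMid_pos (mem_range.1 hi)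
  have hsub : range k ⊆ range n := range_subset_range.2 hk
  have hcs := sum_sq_le_sum_mul_sum_of_sq_le_mul (range k) (r := fun i => u (i + 1) - u i)
    (f := fun i => hMid x i) (g := fun i => hMid x i * ((u (i + 1) - u i) / hMid x i) ^ 2)
    (fun i hi => (hpos i (hsub hi)).le)
    (fun i hi => mul_nonneg (hpos i (hsub hi)).le (sq_nonneg _))
    (fun i hi => le_of_eq (by have := (hpos i (hsub hi)).ne'; field_simp))
  rw [sum_range_sub, h0, sub_zero] at hcs
  have hlen : ∑ i ∈ range k, hMid x i ≤ 1 := by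
    simp only [hMid]
    rw [sum_range_sub, hx.1, sub_zero]
    exact (hx.nonneg_and_le_one k hk).2
  have hnn : 0 ≤ ∑ i ∈ range k, hMid x i * ((u (i + 1) - u i) / hMid x i) ^ 2 :=
    sum_nonneg fun i hi => mul_nonneg (hpos i (hsub hi)).le (sq_nonneg _)
  calc u k ^ 2 ≤ _ := hcs
    _ ≤ ∑ i ∈ range k, hMid x i * ((u (i + 1) - u i) / hMid x i) ^ 2 :=
      mul_le_of_le_one_left hnn hlen
    _ ≤ _ := sum_le_sum_of_subset_of_nonneg hsub fun i hi _ =>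
      mul_nonneg (hpos i hi).le (sq_nonneg _)

/-- The difference quotient `d_x W` at cell centers. -/
def dxQuot (x : ℕ → ℝ) (W : ℕ → ℕ → ℝ) (i j : ℕ) : ℝ := (W (i + 1) j - W i j) / hMid x i

theorem ipTM_self_le {nx ny : ℕ} {x y : ℕ → ℝ} (hnx : 1 ≤ nx) (hx : IsGrid x nx)
    (hy : IsGrid y ny) (W : ℕ → ℕ → ℝ) (h0 : ∀ j < ny, W 0 j = 0) :
    ipTM x y nx ny W W ≤ ipM x y nx ny (dxQuot x W) (dxQuot x W) := by
  unfold ipTM ipM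
  rw [sum_comm, sum_comm (s := range nx)]
  refine sum_le_sum fun j hj => ?_
  have hl := (hy.hMid_pos (mem_range.1 hj)).le
  set E := ∑ i ∈ range nx, hMid x i * ((W (i + 1) j - W i j) / hMid x i) ^ 2 with hE
  have hEnn : 0 ≤ E := sum_nonneg fun i hi =>
    mul_nonneg (hx.hMid_pos (mem_range.1 hi)).le (sq_nonneg _)
  calc ∑ i ∈ Ico 1 nx, hNode x nx i * hMid y j * W i j * W i j
      ≤ ∑ i ∈ Ico 1 nx, hNode x nx i * (hMid y j * E) := by
        refine sum_le_sum fun i hi => ?_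
        have hi := mem_Ico.1 hi
        have h1 := hx.sq_le_sum hi.2.le (fun i => W i j) (h0 j (mem_range.1 hj))
        have h2 := mul_le_mul_of_nonneg_left h1
          (mul_nonneg (hx.hNode_pos hnx hi.2.le).le hl)
        simp only [← hE] at h2
        linarith
    _ = (∑ i ∈ Ico 1 nx, hNode x nx i) * (hMid y j * E) := by rw [sum_mul]
    _ ≤ hMid y j * E := mul_le_of_le_one_left (mul_nonneg hl hEnn) (hx.sum_hNode_le_one hnx)
    _ = _ := by
        rw [hE, mul_sum]
        refine sum_congr rfl fun i _ => ?_
        simp only [dxQuot]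
        ring

/-- Discrete Green formula for one momentum equation. -/
theorem ipTM_momentum {nx ny : ℕ} {x y : ℕ → ℝ} (hnx : 1 ≤ nx) (hny : 1 ≤ ny)
    (hx : IsGrid x nx) (hy : IsGrid y ny) (W : ℕ → ℕ → ℝ) (W0 Wn : ℕ → ℝ) (Z S f : ℕ → ℕ → ℝ)
    (hW : ∀ j < ny, W 0 j = 0 ∧ W nx j = 0) (hW0 : ∀ i ≤ nx, W0 i = 0 ∧ Wn i = 0)
    (hf : ∀ i, 1 ≤ i → i < nx → ∀ j < ny,
      (Z i j - Z (i - 1) j) / hNode x nx i + (S i (j + 1) - S i j) / hMid y j = f i j) :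
    ipTM x y nx ny f W
      = -ipM x y nx ny Z (dxQuot x W) - ipT x y nx ny S (DyE y ny W W0 Wn) := by
  have hsplit : ipTM x y nx ny f W
      = ∑ i ∈ Ico 1 nx, ∑ j ∈ range ny, hMid y j * ((Z i j - Z (i - 1) j) * W i j)
        + ∑ i ∈ Ico 1 nx, hNode x nx i * ∑ j ∈ range ny, (S i (j + 1) - S i j) * W i j := by
    unfold ipTM
    rw [← sum_add_distrib]
    refine sum_congr rfl fun i hi => ?_
    rw [mul_sum, ← sum_add_distrib]
    refine sum_congr rfl fun j hj => ?_
    have hi := mem_Ico.1 hi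
    have hj := mem_range.1 hj
    have h1 := (hx.hNode_pos hnx hi.2.le).ne'
    have h2 := (hy.hMid_pos hj).ne'
    rw [← hf i hi.1 hi.2 j hj]
    field_simp
  have hZ : ∑ i ∈ Ico 1 nx, ∑ j ∈ range ny, hMid y j * ((Z i j - Z (i - 1) j) * W i j)
      = -ipM x y nx ny Z (dxQuot x W) := by
    unfold ipM
    rw [sum_comm, sum_comm (s := range nx), ← sum_neg_distrib]
    refine sum_congr rfl fun j hj => ?_
    have hj := mem_range.1 hj
    rw [← mul_sum, sum_Ico_sub_mul hnx (fun i => Z i j) (fun i => W i j) (hW j hj).1 (hW j hj).2,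
      mul_neg, mul_sum]
    refine congrArg _ (sum_congr rfl fun i hi => ?_)
    have := (hx.hMid_pos (mem_range.1 hi)).ne'
    simp only [dxQuot]
    field_simp
  have hbdry : ∀ i, (i = 0 ∨ i = nx) → ∀ j ∈ range (ny + 1), DyE y ny W W0 Wn i j = 0 := by
    intro i hi j hj
    have hj := mem_range.1 hj
    have hz : ∀ k < ny, W i k = 0 := by
      intro k hk
      rcases hi with rfl | rfl
      exacts [(hW k hk).1, (hW k hk).2]
    have hi' : i ≤ nx := by omega
    unfold DyE
    split_ifs with h1 h2
    · rw [hz 0 (by omega), (hW0 i hi').1]; simp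
    · rw [hz _ (by omega), (hW0 i hi').2]; simp
    · rw [hz j (by omega), hz (j - 1) (by omega)]; simp
  have hS : ∑ i ∈ Ico 1 nx, hNode x nx i * ∑ j ∈ range ny, (S i (j + 1) - S i j) * W i j
      = -ipT x y nx ny S (DyE y ny W W0 Wn) := by
    unfold ipT
    rw [← sum_neg_distrib]
    have hsub : Ico 1 nx ⊆ range (nx + 1) := fun i hi => by
      have := mem_Ico.1 hi
      exact mem_range.2 (by omega)
    rw [← sum_subset hsub]
    · refine sum_congr rfl fun i hi => ?_
      have hi := mem_Ico.1 hi
      rw [hy.sum_range_sub_mul hny (S i) W W0 Wn i (hW0 i hi.2.le).1 (hW0 i hi.2.le).2,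
        mul_neg, mul_sum]
      refine congrArg _ (sum_congr rfl fun j _ => ?_)
      ring
    · intro i hi hni
      rw [mem_range] at hi
      rw [mem_Ico] at hni
      rw [sum_eq_zero, neg_zero]
      intro j hj
      rw [hbdry i (by omega) j hj, mul_zero]
  rw [hsplit, hZ, hS, sub_eq_add_neg]

theorem abs_sum_sum_le_sqrt_mul_sqrt {s t : Finset ℕ} {w : ℕ → ℕ → ℝ}
    (hw : ∀ i ∈ s, ∀ j ∈ t, 0 ≤ w i j) (φ θ : ℕ → ℕ → ℝ) :
    |∑ i ∈ s, ∑ j ∈ t, w i j * φ i j * θ i j|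
      ≤ √(∑ i ∈ s, ∑ j ∈ t, w i j * φ i j * φ i j)
        * √(∑ i ∈ s, ∑ j ∈ t, w i j * θ i j * θ i j) := by
  have hnn : ∀ ψ : ℕ → ℕ → ℝ, ∀ p ∈ s ×ˢ t, 0 ≤ w p.1 p.2 * ψ p.1 p.2 * ψ p.1 p.2 := by
    intro ψ p hp
    rw [mul_assoc]
    exact mul_nonneg (hw _ (mem_product.1 hp).1 _ (mem_product.1 hp).2) (mul_self_nonneg _)
  simp only [← sum_product']
  rw [← Real.sqrt_mul (sum_nonneg (hnn φ))]
  refine Real.abs_le_sqrt (sum_sq_le_sum_mul_sum_of_sq_le_mul _ (hnn φ) (hnn θ) fun p _ => le_of_eq ?_)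
  ring

theorem abs_ipTM_le {nx ny : ℕ} {x y : ℕ → ℝ} (hnx : 1 ≤ nx) (hx : IsGrid x nx)
    (hy : IsGrid y ny) (φ θ : ℕ → ℕ → ℝ) :
    |ipTM x y nx ny φ θ| ≤ √(ipTM x y nx ny φ φ) * √(ipTM x y nx ny θ θ) :=
  abs_sum_sum_le_sqrt_mul_sqrt (w := fun i j => hNode x nx i * hMid y j)
    (fun _ hi _ hj => mul_nonneg (hx.hNode_pos hnx (mem_Ico.1 hi).2.le).le
      (hy.hMid_pos (mem_range.1 hj)).le) φ θ

theorem ipTM_self_nonneg {nx ny : ℕ} {x y : ℕ → ℝ} (hnx : 1 ≤ nx) (hx : IsGrid x nx)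
    (hy : IsGrid y ny) (φ : ℕ → ℕ → ℝ) : 0 ≤ ipTM x y nx ny φ φ := by
  refine sum_nonneg fun i hi => sum_nonneg fun j hj => ?_
  rw [mul_assoc]
  exact mul_nonneg (mul_nonneg (hx.hNode_pos hnx (mem_Ico.1 hi).2.le).le
    (hy.hMid_pos (mem_range.1 hj)).le) (mul_self_nonneg _)

theorem ipM_self_nonneg {nx ny : ℕ} {x y : ℕ → ℝ} (hx : IsGrid x nx)
    (hy : IsGrid y ny) (φ : ℕ → ℕ → ℝ) : 0 ≤ ipM x y nx ny φ φ := by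
  refine sum_nonneg fun i hi => sum_nonneg fun j hj => ?_
  rw [mul_assoc]
  exact mul_nonneg (mul_nonneg (hx.hMid_pos (mem_range.1 hi)).le
    (hy.hMid_pos (mem_range.1 hj)).le) (mul_self_nonneg _)

theorem ipT_self_nonneg {nx ny : ℕ} {x y : ℕ → ℝ} (hnx : 1 ≤ nx) (hny : 1 ≤ ny)
    (hx : IsGrid x nx) (hy : IsGrid y ny) (φ : ℕ → ℕ → ℝ) : 0 ≤ ipT x y nx ny φ φ := by
  refine sum_nonneg fun i hi => sum_nonneg fun j hj => ?_
  rw [mul_assoc]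
  exact mul_nonneg (mul_nonneg (hx.hNode_pos hnx (mem_range_succ_iff.1 hi)).le
    (hy.hNode_pos hny (mem_range_succ_iff.1 hj)).le) (mul_self_nonneg _)

theorem ipMT_eq_ipTM_swap (x y : ℕ → ℝ) (nx ny : ℕ) (φ θ : ℕ → ℕ → ℝ) :
    ipMT x y nx ny φ θ = ipTM y x ny nx (fun a b => φ b a) (fun a b => θ b a) := by
  unfold ipMT ipTM
  rw [sum_comm]
  exact sum_congr rfl fun j _ => sum_congr rfl fun i _ => by ring

theorem ipM_swap (x y : ℕ → ℝ) (nx ny : ℕ) (φ θ : ℕ → ℕ → ℝ) :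
    ipM y x ny nx (fun a b => φ b a) θ = ipM x y nx ny φ (fun a b => θ b a) := by
  unfold ipM
  rw [sum_comm]
  exact sum_congr rfl fun j _ => sum_congr rfl fun i _ => by ring

theorem ipT_swap (x y : ℕ → ℝ) (nx ny : ℕ) (φ θ : ℕ → ℕ → ℝ) :
    ipT y x ny nx (fun a b => φ b a) θ = ipT x y nx ny φ (fun a b => θ b a) := by
  unfold ipT
  rw [sum_comm]
  exact sum_congr rfl fun j _ => sum_congr rfl fun i _ => by ring

/-- Coercivity of the compliance tensor of plane elasticity. -/
theorem compliance_coercive {lam mu : ℝ} (hlam : 0 < lam) (hmu : 0 < mu) (a b : ℝ) :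
    1 / (2 * lam + 2 * mu) * (a * a + b * b)
      ≤ a * (1 / (2 * mu) * (a - lam / (2 * lam + 2 * mu) * (a + b)))
        + b * (1 / (2 * mu) * (b - lam / (2 * lam + 2 * mu) * (a + b))) := by
  have h : a * (1 / (2 * mu) * (a - lam / (2 * lam + 2 * mu) * (a + b)))
        + b * (1 / (2 * mu) * (b - lam / (2 * lam + 2 * mu) * (a + b)))
      - 1 / (2 * lam + 2 * mu) * (a * a + b * b)
      = lam / (2 * mu * (2 * lam + 2 * mu)) * (a - b) ^ 2 := by
    field_simp
    ring
  have : 0 ≤ lam / (2 * mu * (2 * lam + 2 * mu)) * (a - b) ^ 2 := by positivity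
  linarith

/-- Boundedness of the compliance tensor of plane elasticity. -/
theorem compliance_bounded {lam mu : ℝ} (hlam : 0 < lam) (hmu : 0 < mu) (a b : ℝ) :
    (1 / (2 * mu) * (a - lam / (2 * lam + 2 * mu) * (a + b))) ^ 2
        + (1 / (2 * mu) * (b - lam / (2 * lam + 2 * mu) * (a + b))) ^ 2
      ≤ 1 / (2 * mu ^ 2) * (a * a + b * b) := by
  set c := lam / (2 * lam + 2 * mu) with hc
  have hc0 : 0 ≤ c := by positivity
  have hc1 : c ≤ 1 := by
    rw [hc, div_le_one (by positivity)]
    linarith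
  have h : (a - c * (a + b)) ^ 2 + (b - c * (a + b)) ^ 2 ≤ a * a + b * b := by
    nlinarith [mul_nonneg (mul_nonneg hc0 (sub_nonneg.2 hc1)) (sq_nonneg (a + b))]
  have hab : 0 ≤ a * a + b * b := add_nonneg (mul_self_nonneg a) (mul_self_nonneg b)
  calc _ = 1 / (4 * mu ^ 2) * ((a - c * (a + b)) ^ 2 + (b - c * (a + b)) ^ 2) := by
        field_simp
        ring
    _ ≤ 1 / (4 * mu ^ 2) * (a * a + b * b) := by gcongr
    _ ≤ 1 / (2 * mu ^ 2) * (a * a + b * b) := by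
        gcongr
        norm_num

theorem ipT_add_right (x y : ℕ → ℝ) (nx ny : ℕ) (φ θ ψ : ℕ → ℕ → ℝ) :
    ipT x y nx ny φ θ + ipT x y nx ny φ ψ = ipT x y nx ny φ (fun i j => θ i j + ψ i j) := by
  simp only [ipT, ← sum_add_distrib, mul_add]

/-- Energy estimate and Poincaré bound for solutions of the MAC-E scheme. -/
theorem MACESol.energy_bounds {lam mu : ℝ} (hlam : 0 < lam) (hmu : 0 < mu) {nx ny : ℕ}
    (hnx : 1 ≤ nx) (hny : 1 ≤ ny) {x y : ℕ → ℝ} (hx : IsGrid x nx) (hy : IsGrid y ny)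
    {Wx : ℕ → ℕ → ℝ} {Wx0 Wxn : ℕ → ℝ} {Wy : ℕ → ℕ → ℝ} {Wy0 Wyn : ℕ → ℝ}
    {Z11 Z22 Z12 f1 f2 : ℕ → ℕ → ℝ}
    (h : MACESol nx ny x y lam mu Wx Wx0 Wxn Wy Wy0 Wyn Z11 Z22 Z12 f1 f2) :
    1 / mu * ipT x y nx ny Z12 Z12
        + 1 / (2 * lam + 2 * mu) * (ipM x y nx ny Z11 Z11 + ipM x y nx ny Z22 Z22)
      ≤ -ipTM x y nx ny f1 Wx - ipMT x y nx ny f2 Wy ∧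
    ipTM x y nx ny Wx Wx + ipMT x y nx ny Wy Wy
      ≤ 1 / (2 * mu ^ 2) * (ipM x y nx ny Z11 Z11 + ipM x y nx ny Z22 Z22) := by
  obtain ⟨hWx, hWx0, hWy, hWy0, hZ11, hZ22, hZ12, hf1, hf2⟩ := h
  have hw : ∀ i ∈ range nx, ∀ j ∈ range ny, 0 ≤ hMid x i * hMid y j := fun i hi j hj =>
    mul_nonneg (hx.hMid_pos (mem_range.1 hi)).le (hy.hMid_pos (mem_range.1 hj)).le
  rw [ipMT_eq_ipTM_swap, ipMT_eq_ipTM_swap]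
  constructor
  · have e1 := ipTM_momentum hnx hny hx hy Wx Wx0 Wxn Z11 Z12 f1 hWx hWx0 hf1
    have e2 := ipTM_momentum hny hnx hy hx (fun a b => Wy b a) Wy0 Wyn (fun a b => Z22 b a)
      (fun a b => Z12 b a) (fun a b => f2 b a) hWy hWy0
      (fun j h1 h2 i hi => (add_comm _ _).trans (hf2 i hi j h1 h2))
    rw [ipM_swap, ipT_swap] at e2
    have hT : ipT x y nx ny Z12 (DyE y ny Wx Wx0 Wxn)
        + ipT x y nx ny Z12 (fun a b => DyE x nx (fun a b => Wy b a) Wy0 Wyn b a)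
        = 1 / mu * ipT x y nx ny Z12 Z12 := by
      rw [ipT_add_right]
      unfold ipT
      simp only [mul_sum]
      refine sum_congr rfl fun i hi => sum_congr rfl fun j hj => ?_
      have hz : Z12 i j = mu * (DyE y ny Wx Wx0 Wxn i j
          + DyE x nx (fun a b => Wy b a) Wy0 Wyn j i) :=
        hZ12 i (mem_range_succ_iff.1 hi) j (mem_range_succ_iff.1 hj)
      have hz' : DyE y ny Wx Wx0 Wxn i j + DyE x nx (fun a b => Wy b a) Wy0 Wyn j i
          = 1 / mu * Z12 i j := by
        rw [hz]
        field_simp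
      rw [hz']
      ring
    have hM : 1 / (2 * lam + 2 * mu) * (ipM x y nx ny Z11 Z11 + ipM x y nx ny Z22 Z22)
        ≤ ipM x y nx ny Z11 (dxQuot x Wx)
          + ipM x y nx ny Z22 (fun a b => dxQuot y (fun a b => Wy b a) b a) := by
      unfold ipM
      simp only [← sum_add_distrib, mul_sum]
      refine sum_le_sum fun i hi => sum_le_sum fun j hj => ?_
      have h1 := hZ11 i (mem_range.1 hi) j (mem_range.1 hj)
      have h2 := hZ22 i (mem_range.1 hi) j (mem_range.1 hj)
      simp only [dxQuot]
      rw [← h1, ← h2]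
      have := mul_le_mul_of_nonneg_left (compliance_coercive hlam hmu (Z11 i j) (Z22 i j))
        (hw i hi j hj)
      linarith
    linarith
  · have p1 := ipTM_self_le hnx hx hy Wx fun j hj => (hWx j hj).1
    have p2 := ipTM_self_le hny hy hx (fun a b => Wy b a) fun i hi => (hWy i hi).1
    rw [ipM_swap x y nx ny (fun a b => dxQuot y (fun a b => Wy b a) b a)] at p2
    refine (add_le_add p1 p2).trans ?_
    unfold ipM
    simp only [← sum_add_distrib, mul_sum]
    refine sum_le_sum fun i hi => sum_le_sum fun j hj => ?_
    have h1 := hZ11 i (mem_range.1 hi) j (mem_range.1 hj)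
    have h2 := hZ22 i (mem_range.1 hi) j (mem_range.1 hj)
    simp only [dxQuot]
    rw [← h1, ← h2]
    have := mul_le_mul_of_nonneg_left (compliance_bounded hlam hmu (Z11 i j) (Z22 i j))
      (hw i hi j hj)
    linarith

/-- Stability of the MAC-E scheme: there is a constant `C > 0` depending only on `λ`
and `μ` (independent of the partitions) such that every solution of the MAC-E scheme
with data `f¹, f²` satisfies
`(1/μ)‖Z¹²‖_T + (1/(2λ+2μ))(‖Z¹¹‖_M + ‖Z²²‖_M) + ‖W‖ ≤ C(‖f¹‖_{TM} + ‖f²‖_{MT})`. -/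
theorem mac_stability (lam mu : ℝ) (hlam : 0 < lam) (hmu : 0 < mu) :
    ∃ C > (0 : ℝ), ∀ (nx ny : ℕ), 2 ≤ nx → 2 ≤ ny → ∀ (x y : ℕ → ℝ),
      IsGrid x nx → IsGrid y ny →
      ∀ (Wx : ℕ → ℕ → ℝ) (Wx0 Wxn : ℕ → ℝ) (Wy : ℕ → ℕ → ℝ) (Wy0 Wyn : ℕ → ℝ)
        (Z11 Z22 Z12 f1 f2 : ℕ → ℕ → ℝ),
      MACESol nx ny x y lam mu Wx Wx0 Wxn Wy Wy0 Wyn Z11 Z22 Z12 f1 f2 →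
      (1 / mu) * Real.sqrt (ipT x y nx ny Z12 Z12)
        + (1 / (2 * lam + 2 * mu))
            * (Real.sqrt (ipM x y nx ny Z11 Z11) + Real.sqrt (ipM x y nx ny Z22 Z22))
        + Real.sqrt (ipTM x y nx ny Wx Wx + ipMT x y nx ny Wy Wy)
      ≤ C * (Real.sqrt (ipTM x y nx ny f1 f1) + Real.sqrt (ipMT x y nx ny f2 f2)) := by
  set k := (lam + mu) / mu ^ 2 with hk
  have hk0 : 0 < k := by positivity
  refine ⟨1 / mu * √(mu * k) + 1 / (2 * lam + 2 * mu)
    * (√((2 * lam + 2 * mu) * k) + √((2 * lam + 2 * mu) * k)) + k, by positivity, ?_⟩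
  intro nx ny hnx hny x y hx hy Wx Wx0 Wxn Wy Wy0 Wyn Z11 Z22 Z12 f1 f2 h
  have hnx : 1 ≤ nx := by omega
  have hny : 1 ≤ ny := by omega
  obtain ⟨hE, hP⟩ := h.energy_bounds hlam hmu hnx hny hx hy
  have hT := ipT_self_nonneg hnx hny hx hy Z12
  have hZ1 := ipM_self_nonneg hx hy Z11
  have hZ2 := ipM_self_nonneg hx hy Z22
  have hX := ipTM_self_nonneg hnx hx hy Wx
  have hY : 0 ≤ ipMT x y nx ny Wy Wy := by
    rw [ipMT_eq_ipTM_swap]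
    exact ipTM_self_nonneg hny hy hx _
  have c1 := (neg_le_abs _).trans (abs_ipTM_le hnx hx hy f1 Wx)
  have c2 : -ipMT x y nx ny f2 Wy ≤ √(ipMT x y nx ny f2 f2) * √(ipMT x y nx ny Wy Wy) := by
    simp only [ipMT_eq_ipTM_swap]
    exact (neg_le_abs _).trans (abs_ipTM_le hny hy hx _ _)
  set T := ipT x y nx ny Z12 Z12
  set A := ipM x y nx ny Z11 Z11
  set B := ipM x y nx ny Z22 Z22
  set X := ipTM x y nx ny Wx Wx
  set Y := ipMT x y nx ny Wy Wy
  set F1 := √(ipTM x y nx ny f1 f1)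
  set F2 := √(ipMT x y nx ny f2 f2)
  have hF1 : 0 ≤ F1 := Real.sqrt_nonneg _
  have hF2 : 0 ≤ F2 := Real.sqrt_nonneg _
  set W := √(X + Y)
  have hW0 : 0 ≤ W := Real.sqrt_nonneg _
  have hWsq : W ^ 2 = X + Y := Real.sq_sqrt (add_nonneg hX hY)
  have hXW : √X ≤ W := Real.sqrt_le_sqrt (by linarith)
  have hYW : √Y ≤ W := Real.sqrt_le_sqrt (by linarith)
  have hFW : 1 / mu * T + 1 / (2 * lam + 2 * mu) * (A + B) ≤ (F1 + F2) * W := by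
    have := mul_le_mul_of_nonneg_left hXW hF1
    have := mul_le_mul_of_nonneg_left hYW hF2
    linarith
  have hT' : 0 ≤ 1 / mu * T := by positivity
  have hAB' : 0 ≤ 1 / (2 * lam + 2 * mu) * (A + B) := by positivity
  have hAB : A + B ≤ (2 * lam + 2 * mu) * ((F1 + F2) * W) := by
    have h1 : 1 / (2 * lam + 2 * mu) * (A + B) ≤ (F1 + F2) * W := by linarith
    rwa [one_div_mul_eq_div, div_le_iff₀' (by positivity)] at h1
  have hTW : T ≤ mu * ((F1 + F2) * W) := by
    have h1 : 1 / mu * T ≤ (F1 + F2) * W := by linarith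
    rwa [one_div_mul_eq_div, div_le_iff₀' hmu] at h1
  have hWk : W ≤ k * (F1 + F2) := by
    have h1 : W * W ≤ k * (F1 + F2) * W := by
      calc W * W = X + Y := by rw [← hWsq, sq]
        _ ≤ 1 / (2 * mu ^ 2) * (A + B) := hP
        _ ≤ 1 / (2 * mu ^ 2) * ((2 * lam + 2 * mu) * ((F1 + F2) * W)) := by gcongr
        _ = k * (F1 + F2) * W := by rw [hk]; field_simp
    rcases hW0.eq_or_lt with h0 | h0
    · rw [← h0]; positivity
    · exact le_of_mul_le_mul_right h1 h0
  have hFk : (F1 + F2) * W ≤ k * (F1 + F2) ^ 2 := by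
    have := mul_le_mul_of_nonneg_left hWk (add_nonneg hF1 hF2)
    linarith
  have hroot : ∀ {a c : ℝ}, 0 < c → a ≤ c * ((F1 + F2) * W) → √a ≤ √(c * k) * (F1 + F2) := by
    intro a c hc ha
    refine Real.sqrt_le_iff.2 ⟨by positivity, ha.trans ?_⟩
    rw [mul_pow, Real.sq_sqrt (by positivity)]
    rw [mul_assoc]
    exact mul_le_mul_of_nonneg_left hFk hc.le
  have r1 := mul_le_mul_of_nonneg_left (hroot hmu hTW) (by positivity : 0 ≤ 1 / mu)
  have hc : 0 < 2 * lam + 2 * mu := by positivity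
  have r2 := mul_le_mul_of_nonneg_left
    (add_le_add (hroot (a := A) hc (by linarith)) (hroot (a := B) hc (by linarith)))
    (by positivity : 0 ≤ 1 / (2 * lam + 2 * mu))
  linarith
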